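/- arXiv:2309.07793 — 3 statements merged into one kernel-verified Lean document; each statement's English description precedes it below -/
import Mathlib

section
/- Fix an integer m ≥ 7 and a point x ∈ C_m all of whose coordinates are positive. If e(x) = m − 3 and d(x) = 1, then m is even and there is no Apéry point y of C_m with E(y) = E(x). -/
open scoped BigOperators

/-- The Kunz cone `C_m`: points indexed by residues modulo `m` (the coordinate at `0` is
ignored) satisfying `x i + x j ≥ x (i+j)` for nonzero `i, j` with `i + j ≠ 0`. -/
def KunzCone (m : ℕ) : Set (ZMod m → ℝ) :=
  {x | ∀ i j : ZMod m, i ≠ 0 → j ≠ 0 → i + j ≠ 0 → x (i + j) ≤ x i + x j}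

/-- The equality set `E(x)` of a point of the Kunz cone. -/
def EqualitySet (m : ℕ) (x : ZMod m → ℝ) : Set (ZMod m × ZMod m) :=
  {p | p.1 ≠ 0 ∧ p.2 ≠ 0 ∧ p.1 + p.2 ≠ 0 ∧ x p.1 + x p.2 = x (p.1 + p.2)}

/-- An Apéry point of `C_m`: a point of the cone with integer coordinates with
`y i ≡ i (mod m)` for every nonzero `i`. -/
def IsAperyPoint (m : ℕ) (y : ZMod m → ℝ) : Prop :=
  y ∈ KunzCone m ∧ ∀ i : ZMod m, i ≠ 0 → ∃ z : ℤ, y i = (z : ℝ) ∧ (z : ZMod m) = i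

/-- The atoms `A(x)` of a point of the Kunz cone with positive coordinates. -/
def KunzAtoms (m : ℕ) (x : ZMod m → ℝ) : Set (ZMod m) :=
  {a | a ≠ 0 ∧ ∀ i j : ZMod m, i ≠ 0 → j ≠ 0 → i + j = a → x i + x j ≠ x a}

/-- `e(x)`, the number of atoms. -/
noncomputable def kunzE (m : ℕ) (x : ZMod m → ℝ) : ℕ := (KunzAtoms m x).ncard

/-- The normal vector `e_i + e_j - e_{i+j}` of a supporting hyperplane of the Kunz cone. -/
def hypVec (m : ℕ) (i j : ZMod m) : ZMod m → ℚ :=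
  Pi.single i 1 + Pi.single j 1 - Pi.single (i + j) 1

/-- `d(x)`, the dimension of the face of `C_m` whose relative interior contains `x`. -/
noncomputable def kunzD (m : ℕ) (x : ZMod m → ℝ) : ℕ :=
  (m - 1) - Module.finrank ℚ (Submodule.span ℚ
    {v : ZMod m → ℚ | ∃ p ∈ EqualitySet m x, v = hypVec m p.1 p.2})

/-- `z : ℕ^{A(x)}` is a factorization of the nonzero residue `a`. -/
def IsKunzFactorization (m : ℕ) [NeZero m] (x : ZMod m → ℝ) (a : ZMod m)
    (z : ZMod m → ℕ) : Prop :=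
  (∀ c, z c ≠ 0 → c ∈ KunzAtoms m x) ∧
  (∑ c : ZMod m, (z c : ZMod m) * c) = a ∧
  (∑ c : ZMod m, (z c : ℝ) * x c) = x a

/-- `Z(a)`, the set of factorizations of `a`. -/
def KunzFactorizations (m : ℕ) [NeZero m] (x : ZMod m → ℝ) (a : ZMod m) :
    Set (ZMod m → ℕ) :=
  {z | IsKunzFactorization m x a z}

/-- The presentation lattice `L(x)`: the subgroup of `ℤ^{A(x)}` generated by all differences
of pairs of factorizations of a common nonzero residue. -/
def PresentationLattice (m : ℕ) [NeZero m] (x : ZMod m → ℝ) :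
    AddSubgroup (ZMod m → ℤ) :=
  AddSubgroup.closure {v | ∃ a : ZMod m, a ≠ 0 ∧ ∃ z z',
    z ∈ KunzFactorizations m x a ∧ z' ∈ KunzFactorizations m x a ∧
    v = fun c => (z c : ℤ) - (z' c : ℤ)}

/-- If `d(x) = 1`, any solution of the equations in `E(x)` is a multiple of `x`
on the nonzero residues. -/
theorem exists_eq_mul_of_kunzD_eq_one (m : ℕ) (hm : 2 ≤ m) [NeZero m] (x : ZMod m → ℝ)
    (hpos : ∀ i : ZMod m, i ≠ 0 → 0 < x i) (hd : kunzD m x = 1) (v : ZMod m → ℝ)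
    (hv : ∀ i j, (i, j) ∈ EqualitySet m x → v i + v j = v (i + j)) :
    ∃ r : ℝ, ∀ i, i ≠ 0 → v i = r * x i := by
  classical
  set S : Submodule ℚ (ZMod m → ℚ) := Submodule.span ℚ
    {v : ZMod m → ℚ | ∃ p ∈ EqualitySet m x, v = hypVec m p.1 p.2} with hS
  have hfin : Module.finrank ℚ S = m - 2 := by
    have : (m - 1) - Module.finrank ℚ S = 1 := hd
    omega
  have hzero : ∀ q ∈ S, q 0 = 0 := by
    intro q hq
    have hle : S ≤ LinearMap.ker (LinearMap.proj 0 : (ZMod m → ℚ) →ₗ[ℚ] ℚ) := by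
      rw [hS, Submodule.span_le]
      rintro _ ⟨⟨i, j⟩, ⟨hi, hj, hij, -⟩, rfl⟩
      simp only [] at hi hj hij
      simp [hypVec, hi.symm, hj.symm, hij.symm]
    simpa using hle hq
  let e₀ : ZMod m → ℚ := Pi.single 0 1
  set T : Submodule ℚ (ZMod m → ℚ) := S ⊔ Submodule.span ℚ {e₀} with hT
  have hlt : S < T := by
    refine lt_of_le_of_ne le_sup_left fun h => ?_
    have h0 : e₀ ∈ T := Submodule.mem_sup_right (Submodule.mem_span_singleton_self _)
    rw [← h] at h0
    simpa [e₀] using hzero _ h0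
  have hquot : Module.finrank ℚ ((ZMod m → ℚ) ⧸ T) ≤ 1 := by
    have h1 := Submodule.finrank_lt_finrank_of_lt hlt
    have h2 := Submodule.finrank_quotient_add_finrank T
    rw [Module.finrank_fintype_fun_eq_card, ZMod.card] at h2
    omega
  obtain ⟨g, hg⟩ := finrank_le_one_iff.mp hquot
  choose c hc using fun i : ZMod m => hg (T.mkQ (Pi.single i 1))
  have key : ∀ u : ZMod m → ℝ, (∀ i j, (i, j) ∈ EqualitySet m x → u i + u j = u (i + j)) →
      ∃ R : ℝ, ∀ i, i ≠ 0 → u i = c i * R := by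
    intro u hu
    let φ : (ZMod m → ℚ) →ₗ[ℚ] ℝ :=
      Fintype.linearCombination ℚ (fun i => if i = 0 then 0 else u i)
    have hφ : ∀ i, φ (Pi.single i 1) = if i = 0 then 0 else u i := by
      intro i
      simp [φ, Fintype.linearCombination_apply_single]
    have hker : T ≤ LinearMap.ker φ := by
      rw [hT, sup_le_iff, hS, Submodule.span_le, Submodule.span_le]
      constructor
      · rintro _ ⟨⟨i, j⟩, h, rfl⟩
        obtain ⟨hi, hj, hij, -⟩ := id h
        simp only [] at hi hj hij
        have := hu i j h
        simp only [hypVec, SetLike.mem_coe, LinearMap.mem_ker, map_add, map_sub, hφ, hi, hj, hij,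
          if_false]
        linarith
      · rintro _ rfl
        simp [e₀, hφ]
    refine ⟨T.liftQ φ hker g, fun i hi => ?_⟩
    have h := congrArg (T.liftQ φ hker) (hc i)
    rw [map_smul, Submodule.mkQ_apply, Submodule.liftQ_apply, hφ, if_neg hi, Rat.smul_def] at h
    exact h.symm
  obtain ⟨R, hR⟩ := key x fun i j h => h.2.2.2
  obtain ⟨R', hR'⟩ := key v hv
  have : Fact (1 < m) := ⟨by omega⟩
  have hR0 : R ≠ 0 := by
    rintro rfl
    have h1 := hR 1 one_ne_zero
    have h2 := hpos 1 one_ne_zero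
    simp at h1
    linarith
  refine ⟨R' / R, fun i hi => ?_⟩
  rw [hR i hi, hR' i hi]
  field_simp

/-- A positive point `x` spanning the solution space of its equations whose only nonzero
residues that are not atoms are `b` and `c`, with `x b ≤ x c`. -/
structure IsRigidPair (m : ℕ) (x : ZMod m → ℝ) (b c : ZMod m) : Prop where
  left_ne : b ≠ 0
  right_ne : c ≠ 0
  ne : b ≠ c
  pos : ∀ i, i ≠ 0 → 0 < x i
  le : x b ≤ x c
  atom : ∀ i j, i ≠ 0 → j ≠ 0 → i + j ≠ 0 → i + j ≠ b → i + j ≠ c → x i + x j ≠ x (i + j)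
  rigid : ∀ v : ZMod m → ℝ, (∀ i j, (i, j) ∈ EqualitySet m x → v i + v j = v (i + j)) →
    ∃ r : ℝ, ∀ i, i ≠ 0 → v i = r * x i

namespace IsRigidPair

variable {m : ℕ} {x : ZMod m → ℝ} {b c : ZMod m}

theorem sub_ne (h : IsRigidPair m x b c) : c - b ≠ 0 := sub_ne_zero.mpr h.ne.symm

theorem add_eq (h : IsRigidPair m x b c) {i j : ZMod m} (hij : (i, j) ∈ EqualitySet m x) :
    i + j = b ∨ i + j = c := by
  obtain ⟨hi, hj, hs, he⟩ := hij
  by_contra hn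
  push Not at hn
  exact h.atom i j hi hj hs hn.1 hn.2 he

/-- It suffices to check the equations between atoms and the one relating `b` and `c`. -/
theorem exists_eq_mul (h : IsRigidPair m x b c) (v : ZMod m → ℝ)
    (hvb : ∀ i j, i ≠ 0 → i ≠ b → i ≠ c → j ≠ 0 → j ≠ b → j ≠ c → i + j = b →
      x i + x j = x b → v i + v j = v b)
    (hvc : ∀ i j, i ≠ 0 → i ≠ b → i ≠ c → j ≠ 0 → j ≠ b → j ≠ c → i + j = c →
      x i + x j = x c → v i + v j = v c)
    (hvt : x b + x (c - b) = x c → v b + v (c - b) = v c) :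
    ∃ r : ℝ, ∀ i, i ≠ 0 → v i = r * x i := by
  refine h.rigid v fun i j hij => ?_
  obtain ⟨hi, hj, hs, he⟩ := id hij
  simp only [] at hi hj hs he
  have hpi := h.pos i hi
  have hpj := h.pos j hj
  have hle := h.le
  rcases h.add_eq hij with hb | hc
  · rw [hb] at he ⊢
    refine hvb i j hi ?_ ?_ hj ?_ ?_ hb he
    · rintro rfl; exact hj (by simpa using hb)
    · rintro rfl; linarith
    · rintro rfl; exact hi (by simpa using hb)
    · rintro rfl; linarith
  · rw [hc] at he ⊢
    by_cases hib : i = b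
    · subst hib
      obtain rfl : j = c - i := by rw [← hc]; ring
      exact hvt he
    by_cases hjb : j = b
    · subst hjb
      obtain rfl : i = c - j := by rw [← hc]; ring
      rw [add_comm]
      exact hvt (by rw [add_comm]; exact he)
    refine hvc i j hi hib ?_ hj hjb ?_ hc he
    · rintro rfl; exact hj (by simpa using hc)
    · rintro rfl; exact hi (by simpa using hc)

/-- A solution vanishing at `b` vanishes at all nonzero residues. -/
theorem eq_zero (h : IsRigidPair m x b c) {v : ZMod m → ℝ}
    (hr : ∃ r : ℝ, ∀ i, i ≠ 0 → v i = r * x i) (hv : v b = 0) {i : ZMod m} (hi : i ≠ 0) :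
    v i = 0 := by
  obtain ⟨r, hr⟩ := hr
  have h1 := hr b h.left_ne
  have h2 := h.pos b h.left_ne
  have : r = 0 := by
    rw [hv] at h1
    rcases mul_eq_zero.mp h1.symm with h | h
    · exact h
    · linarith
  rw [hr i hi, this, zero_mul]

/-- A solution taking the same nonzero value at `b` and `c` forces `x b = x c`. -/
theorem eq_of_apply_eq (h : IsRigidPair m x b c) {v : ZMod m → ℝ}
    (hr : ∃ r : ℝ, ∀ i, i ≠ 0 → v i = r * x i) (hb : v b = 1) (hc : v c = 1) :
    x b = x c := by
  obtain ⟨r, hr⟩ := hr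
  have h1 := hr b h.left_ne
  have h2 := hr c h.right_ne
  have hr0 : r ≠ 0 := by
    rintro rfl
    rw [hb] at h1
    simp at h1
  exact mul_left_cancel₀ hr0 (by rw [← h1, ← h2, hb, hc])

/-- Every atom is a fixed point of the reflection at `b`, or congruent to `0` or `b`, modulo the
multiples of the pair `(x c - x b, c - b)`. -/
theorem atom_cases (h : IsRigidPair m x b c) {p : ZMod m} (hp : p ≠ 0) (hpb : p ≠ b)
    (hpc : p ≠ c) :
    (∃ k : ℤ, 2 * x p = x b + k * (x c - x b) ∧ 2 * p = b + k * (c - b)) ∨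
    (x b + x (c - b) = x c ∧ ∃ k : ℤ, (x p = k * (x c - x b) ∧ p = k * (c - b)) ∨
      (x p = x b + k * (x c - x b) ∧ p = b + k * (c - b))) := by
  classical
  by_contra hcon
  rw [not_or, not_exists] at hcon
  obtain ⟨hfix, hmul⟩ := hcon
  let P : ZMod m → Prop := fun i => ∃ k : ℤ, x i = x p + k * (x c - x b) ∧ i = p + k * (c - b)
  let N : ZMod m → Prop := fun i =>
    ∃ k : ℤ, x i = x b - x p + k * (x c - x b) ∧ i = b - p + k * (c - b)
  have PNb : ∀ i j, i + j = b → x i + x j = x b → P i → N j := by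
    rintro i j hij hx ⟨k, h1, h2⟩
    refine ⟨-k, ?_, ?_⟩
    · push_cast; linear_combination hx - h1
    · push_cast; linear_combination hij - h2
  have NPb : ∀ i j, i + j = b → x i + x j = x b → N i → P j := by
    rintro i j hij hx ⟨k, h1, h2⟩
    refine ⟨-k, ?_, ?_⟩
    · push_cast; linear_combination hx - h1
    · push_cast; linear_combination hij - h2
  have PNc : ∀ i j, i + j = c → x i + x j = x c → P i → N j := by
    rintro i j hij hx ⟨k, h1, h2⟩
    refine ⟨1 - k, ?_, ?_⟩
    · push_cast; linear_combination hx - h1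
    · push_cast; linear_combination hij - h2
  have NPc : ∀ i j, i + j = c → x i + x j = x c → N i → P j := by
    rintro i j hij hx ⟨k, h1, h2⟩
    refine ⟨1 - k, ?_, ?_⟩
    · push_cast; linear_combination hx - h1
    · push_cast; linear_combination hij - h2
  let f : ZMod m → ℝ := fun i => (if P i then 1 else 0) - (if N i then 1 else 0)
  let v : ZMod m → ℝ := fun i => if i = b ∨ i = c then 0 else f i
  have hvb : v b = 0 := by simp [v]
  have hvc : v c = 0 := by simp [v]
  have hv : ∀ i, i ≠ b → i ≠ c → v i = f i := fun i h1 h2 => by simp [v, h1, h2]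
  have hfsum : ∀ i j, (P i ↔ N j) → (N i ↔ P j) → f i + f j = 0 := by
    intro i j h1 h2
    simp only [f, h1, h2]
    ring
  have hsol := h.exists_eq_mul v
    (fun i j _ hib hic _ hjb hjc hij hx => by
      rw [hv i hib hic, hv j hjb hjc, hvb]
      have hij' : j + i = b := by rw [add_comm, hij]
      have hx' : x j + x i = x b := by rw [add_comm, hx]
      exact hfsum i j ⟨PNb i j hij hx, NPb j i hij' hx'⟩ ⟨NPb i j hij hx, PNb j i hij' hx'⟩)
    (fun i j _ hib hic _ hjb hjc hij hx => by
      rw [hv i hib hic, hv j hjb hjc, hvc]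
      have hij' : j + i = c := by rw [add_comm, hij]
      have hx' : x j + x i = x c := by rw [add_comm, hx]
      exact hfsum i j ⟨PNc i j hij hx, NPc j i hij' hx'⟩ ⟨NPc i j hij hx, PNc j i hij' hx'⟩)
    (fun hx => by
      rw [hvb, hvc, zero_add]
      have hP : ¬ P (c - b) := by
        rintro ⟨k, h1, h2⟩
        refine hmul ⟨hx, 1 - k, Or.inl ⟨?_, ?_⟩⟩
        · push_cast; linear_combination hx - h1
        · push_cast; linear_combination -h2
      have hN : ¬ N (c - b) := by
        rintro ⟨k, h1, h2⟩
        refine hmul ⟨hx, k - 1, Or.inr ⟨?_, ?_⟩⟩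
        · push_cast; linear_combination h1 - hx
        · push_cast; linear_combination h2
      simp [v, f, hP, hN])
  have hzero := h.eq_zero hsol hvb hp
  have hPp : P p := ⟨0, by simp, by simp⟩
  have hNp : ¬ N p := by
    rintro ⟨k, h1, h2⟩
    refine hfix k ⟨?_, ?_⟩
    · linear_combination h1
    · linear_combination h2
  rw [hv p hpb hpc] at hzero
  simp [f, hPp, hNp] at hzero

/-- Every atom other than `c - b` occurs in an equation. -/
theorem exists_mem_equalitySet (h : IsRigidPair m x b c) {i : ZMod m} (hi : i ≠ 0)
    (hib : i ≠ b) (hic : i ≠ c) (hit : i ≠ c - b) : ∃ j, (i, j) ∈ EqualitySet m x := by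
  classical
  by_contra hn
  push Not at hn
  have hsol := h.rigid (Pi.single i 1) fun j k hjk => by
    obtain ⟨hj, hk, hs, he⟩ := id hjk
    simp only [] at hj hk hs he
    have h1 : j ≠ i := by rintro rfl; exact hn _ hjk
    have h2 : k ≠ i := by
      rintro rfl
      exact hn j ⟨hk, hj, by simpa [add_comm] using hs, by simpa [add_comm] using he⟩
    have h3 : j + k ≠ i := by
      rcases h.add_eq hjk with h' | h' <;> rw [h']
      · exact hib.symm
      · exact hic.symm
    simp [h1, h2, h3]
  have := h.eq_zero hsol (by simp [hib.symm]) hi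
  simp at this

theorem lt_of_atom (h : IsRigidPair m x b c) {i : ZMod m} (hi : i ≠ 0)
    (hib : i ≠ b) (hic : i ≠ c) (hit : i ≠ c - b) : x i < x c := by
  obtain ⟨j, hj⟩ := h.exists_mem_equalitySet hi hib hic hit
  have hpj := h.pos j hj.2.1
  have hle := h.le
  have he := hj.2.2.2
  simp only [] at he
  rcases h.add_eq hj with h' | h' <;> rw [h'] at he <;> linarith

/-- If `x b < x c` then `x c = x b + x (c - b)`. -/
theorem relation_of_lt (h : IsRigidPair m x b c) (hlt : x b < x c) :
    x b + x (c - b) = x c := by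
  classical
  by_contra hn
  have hsol := h.exists_eq_mul (fun i => if i = b ∨ i = c then 1 else 1 / 2)
    (fun i j _ hib hic _ hjb hjc _ _ => by simp [hib, hic, hjb, hjc]; norm_num)
    (fun i j _ hib hic _ hjb hjc _ _ => by simp [hib, hic, hjb, hjc]; norm_num)
    (fun hx => absurd hx hn)
  exact hlt.ne (h.eq_of_apply_eq hsol (by simp) (by simp))

/-- If `x b < x c` then `b` is a small multiple of `c - b`. -/
theorem relation_cases (h : IsRigidPair m x b c) (hlt : x b < x c) :
    c - b = b ∨ (2 * (c - b) = b ∧ 2 * x (c - b) = x b) := by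
  classical
  by_contra hcon
  rw [not_or] at hcon
  obtain ⟨htb, htt⟩ := hcon
  have hrel := h.relation_of_lt hlt
  set t := c - b with ht
  have ht0 : t ≠ 0 := h.sub_ne
  have htc : t ≠ c := fun h' => h.left_ne (by rw [ht] at h'; linear_combination -h')
  let v : ZMod m → ℝ := fun i => if i = b ∨ i = c then 1 else if i = t then 0 else
    if t + i = b ∧ x t + x i = x b then 1 else 1 / 2
  have hvb : v b = 1 := by simp [v]
  have hvc : v c = 1 := by simp [v]
  have hvt : v t = 0 := by simp [v, htb, htc]
  have hσ : ∀ j, j ≠ b → j ≠ c → t + j = b → x t + x j = x b → v t + v j = 1 := by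
    intro j hjb hjc hs hx
    have hjt : j ≠ t := by
      rintro rfl
      exact htt ⟨by rw [two_mul]; exact hs, by rw [two_mul]; exact hx⟩
    rw [hvt]
    simp [v, hjb, hjc, hjt, hs, hx]
  have hno : ∀ i j, i ≠ 0 → i ≠ b → i ≠ c → j ≠ 0 → j ≠ b → j ≠ c → i + j = c →
      x i + x j = x c → t + i = b → x t + x i = x b → False := by
    intro i j _ _ _ _ hjb hjc hs hx hs' hx'
    have hj : t + t = j := by linear_combination ht - hs + hs'
    refine h.atom t t ht0 ht0 ?_ ?_ ?_ ?_
    · rwa [hj]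
    · rwa [hj]
    · rwa [hj]
    · rw [hj]
      linarith
  have hval : ∀ i, i ≠ b → i ≠ c → i ≠ t → ¬ (t + i = b ∧ x t + x i = x b) → v i = 1 / 2 := by
    intro i h1 h2 h3 h4
    simp only [v]
    rw [if_neg (by tauto), if_neg h3, if_neg h4]
  have hsol := h.exists_eq_mul v
    (fun i j hi hib hic hj hjb hjc hs hx => by
      rw [hvb]
      by_cases hit : i = t
      · subst hit
        exact hσ j hjb hjc hs hx
      by_cases hjt : j = t
      · subst hjt
        rw [add_comm]
        exact hσ i hib hic (by rw [add_comm]; exact hs) (by rw [add_comm]; exact hx)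
      rw [hval i hib hic hit, hval j hjb hjc hjt]
      · norm_num
      · rintro ⟨h1, -⟩
        exact hit (by linear_combination hs - h1)
      · rintro ⟨h1, -⟩
        exact hjt (by linear_combination hs - h1))
    (fun i j hi hib hic hj hjb hjc hs hx => by
      rw [hvc]
      have hit : i ≠ t := fun h' => hjb (by linear_combination hs - h' + ht)
      have hjt : j ≠ t := fun h' => hib (by linear_combination hs - h' + ht)
      rw [hval i hib hic hit, hval j hjb hjc hjt]
      · norm_num
      · rintro ⟨h1, h2⟩
        exact hno j i hj hjb hjc hi hib hic (by rw [add_comm]; exact hs)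
          (by rw [add_comm]; exact hx) h1 h2
      · rintro ⟨h1, h2⟩
        exact hno i j hi hib hic hj hjb hjc hs hx h1 h2)
    (fun _ => by rw [hvb, hvc, hvt, add_zero])
  exact hlt.ne (h.eq_of_apply_eq hsol hvb hvc)


theorem not_atom (h : IsRigidPair m x b c) {i j p : ZMod m} (hi : i ≠ 0) (hj : j ≠ 0)
    (hp : p ≠ 0) (hpb : p ≠ b) (hpc : p ≠ c) (hij : i + j = p) (hx : x i + x j = x p) :
    False := by
  subst hij
  exact h.atom i j hi hj hp hpb hpc hx

/-- When `b = c - b`, all atoms are half-multiples of `b`. -/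
theorem atom_cases_of_eq_left (h : IsRigidPair m x b c) (hlt : x b < x c) (hb : c - b = b)
    {p : ZMod m} (hp : p ≠ 0) (hpb : p ≠ b) (hpc : p ≠ c) :
    (2 * p = b ∧ 2 * x p = x b) ∨ (2 * p = 2 * b ∧ 2 * x p = 2 * x b) ∨ 2 * p = 3 * b := by
  have hrel := h.relation_of_lt hlt
  rw [hb] at hrel
  have hpos := h.pos p hp
  have hbpos := h.pos b h.left_ne
  have hplt := h.lt_of_atom hp hpb hpc (by rwa [hb])
  have hxc : x c - x b = x b := by linarith
  obtain ⟨k, hk, hk'⟩ : ∃ k : ℤ, 2 * x p = k * x b ∧ 2 * p = k * b := by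
    rcases h.atom_cases hp hpb hpc with ⟨k, h1, h2⟩ | ⟨-, k, ⟨h1, h2⟩ | ⟨h1, h2⟩⟩ <;>
      rw [hxc] at h1 <;> rw [hb] at h2
    · exact ⟨k + 1, by push_cast; linear_combination h1, by push_cast; linear_combination h2⟩
    · exact ⟨2 * k, by push_cast; linear_combination 2 * h1,
        by push_cast; linear_combination 2 * h2⟩
    · exact ⟨2 * (k + 1), by push_cast; linear_combination 2 * h1,
        by push_cast; linear_combination 2 * h2⟩
  have h0 : 0 < k := by
    by_contra hn
    have : (k : ℝ) ≤ 0 := by exact_mod_cast not_lt.mp hn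
    nlinarith
  have h4 : k < 4 := by
    by_contra hn
    have : (4 : ℝ) ≤ k := by exact_mod_cast not_lt.mp hn
    nlinarith
  interval_cases k
  · left
    constructor
    · simpa using hk'
    · simpa using hk
  · right; left
    constructor
    · simpa using hk'
    · simpa using hk
  · right; right
    simpa using hk'

/-- When `b = 2 * (c - b)`, all atoms are half-multiples of `c - b`. -/
theorem atom_cases_of_eq_double (h : IsRigidPair m x b c) (hlt : x b < x c) {t : ZMod m}
    (ht : c - b = t) (hb : 2 * t = b) (hxb : 2 * x t = x b)
    {p : ZMod m} (hp : p ≠ 0) (hpb : p ≠ b) (hpc : p ≠ c) (hpt : p ≠ t) :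
    2 * p = 2 * t ∨ 2 * p = 3 * t ∨ 2 * p = 4 * t := by
  have hrel := h.relation_of_lt hlt
  rw [ht] at hrel
  have ht0 : t ≠ 0 := ht ▸ h.sub_ne
  have htb : t ≠ b := fun h' => ht0 (by linear_combination hb - h')
  have htc : t ≠ c := fun h' => h.left_ne (by linear_combination -ht - h')
  have hpos := h.pos p hp
  have htpos := h.pos t ht0
  have hplt := h.lt_of_atom hp hpb hpc (by rwa [ht])
  have hxc : x c - x b = x t := by linarith
  have half : ∀ q : ZMod m, q ≠ 0 → 2 * q = t → 2 * x q = x t → False := fun q hq h1 h2 =>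
    h.not_atom hq hq ht0 htb htc (by rw [← two_mul, h1]) (by rw [← two_mul, h2])
  obtain ⟨k, hk, hk'⟩ : ∃ k : ℤ, 2 * x p = k * x t ∧ 2 * p = k * t := by
    rcases h.atom_cases hp hpb hpc with ⟨k, h1, h2⟩ | ⟨-, k, ⟨h1, h2⟩ | ⟨h1, h2⟩⟩ <;>
      rw [hxc] at h1 <;> rw [ht] at h2
    · exact ⟨k + 2, by push_cast; linear_combination h1 - hxb,
        by push_cast; linear_combination h2 - hb⟩
    · exact ⟨2 * k, by push_cast; linear_combination 2 * h1,
        by push_cast; linear_combination 2 * h2⟩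
    · exact ⟨2 * (k + 2), by push_cast; linear_combination 2 * h1 - 2 * hxb,
        by push_cast; linear_combination 2 * h2 - 2 * hb⟩
  have h0 : 0 < k := by
    by_contra hn
    have : (k : ℝ) ≤ 0 := by exact_mod_cast not_lt.mp hn
    nlinarith
  have h6 : k < 6 := by
    by_contra hn
    have : (6 : ℝ) ≤ k := by exact_mod_cast not_lt.mp hn
    nlinarith
  interval_cases k
  · exact (half p hp (by simpa using hk') (by simpa using hk)).elim
  · left
    simpa using hk'
  · right; left
    simpa using hk'
  · right; right
    simpa using hk'
  · exfalso
    push_cast at hk hk'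
    obtain ⟨j, hj⟩ := h.exists_mem_equalitySet hp hpb hpc (by rwa [ht])
    have hj0 : j ≠ 0 := hj.2.1
    have hjpos := h.pos j hj0
    have he := hj.2.2.2
    simp only [] at he
    rcases h.add_eq hj with hs | hs <;> rw [hs] at he
    · linarith
    · exact half j hj0 (by linear_combination 2 * hs - hk' + 2 * ht - 2 * hb) (by linarith)

end IsRigidPair

theorem card_filter_two_mul_eq_le (m : ℕ) [NeZero m] (a : ZMod m) :
    (Finset.univ.filter fun i : ZMod m => 2 * i = a).card ≤ 2 := by
  classical
  rcases Finset.eq_empty_or_nonempty (Finset.univ.filter fun i : ZMod m => 2 * i = a) with h | h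
  · simp [h]
  · obtain ⟨i₀, hi₀⟩ := h
    simp only [Finset.mem_filter, Finset.mem_univ, true_and] at hi₀
    refine le_trans ?_ (IsAddCyclic.card_nsmul_eq_zero_le (α := ZMod m) (n := 2) two_pos)
    refine Finset.card_le_card_of_injOn (fun i => i - i₀) ?_ fun i _ j _ hij => by simpa using hij
    intro i hi
    simp only [Finset.coe_filter, Finset.mem_univ, true_and, Set.mem_ofPred_eq] at hi ⊢
    rw [nsmul_eq_mul]
    push_cast
    linear_combination hi - hi₀

/-- Doubling is at most two-to-one, so few residues have their double in a given triple. -/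
theorem le_card_add_six (m : ℕ) [NeZero m] (s : Finset (ZMod m)) (a₁ a₂ a₃ : ZMod m)
    (h : ∀ p, p ∉ s → 2 * p = a₁ ∨ 2 * p = a₂ ∨ 2 * p = a₃) : m ≤ s.card + 6 := by
  classical
  have hsub : (Finset.univ : Finset (ZMod m)) ⊆ s ∪
      ((Finset.univ.filter fun i : ZMod m => 2 * i = a₁) ∪
      ((Finset.univ.filter fun i : ZMod m => 2 * i = a₂) ∪
      (Finset.univ.filter fun i : ZMod m => 2 * i = a₃))) := by
    intro p _
    by_cases hp : p ∈ s
    · simp [hp]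
    · simpa [hp] using h p hp
  have h1 := Finset.card_le_card hsub
  rw [Finset.card_univ, ZMod.card] at h1
  have h2 := Finset.card_union_le s
    ((Finset.univ.filter fun i : ZMod m => 2 * i = a₁) ∪
      ((Finset.univ.filter fun i : ZMod m => 2 * i = a₂) ∪
      (Finset.univ.filter fun i : ZMod m => 2 * i = a₃)))
  have h3 := Finset.card_union_le (Finset.univ.filter fun i : ZMod m => 2 * i = a₁)
      ((Finset.univ.filter fun i : ZMod m => 2 * i = a₂) ∪
      (Finset.univ.filter fun i : ZMod m => 2 * i = a₃))
  have h4 := Finset.card_union_le (Finset.univ.filter fun i : ZMod m => 2 * i = a₂)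
      (Finset.univ.filter fun i : ZMod m => 2 * i = a₃)
  have := card_filter_two_mul_eq_le m a₁
  have := card_filter_two_mul_eq_le m a₂
  have := card_filter_two_mul_eq_le m a₃
  omega

theorem exists_residue_of_double (m : ℕ) (hm : 7 ≤ m) (hm' : m ≤ 10) (t : ZMod m)
    (h2 : 2 * t ≠ 0) (h3 : 3 * t ≠ 0) :
    ∃ i : ZMod m, i ≠ 0 ∧ i ≠ t ∧ i ≠ 2 * t ∧ i ≠ 3 * t ∧
      2 * i ≠ 2 * t ∧ 2 * i ≠ 3 * t ∧ 2 * i ≠ 4 * t := by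
  interval_cases m <;> revert t <;> decide

theorem exists_residue_of_left (m : ℕ) (hm : 7 ≤ m) (hm' : m ≤ 9) (t : ZMod m)
    (h1 : t ≠ 0) (h2 : 2 * t ≠ 0) :
    (∃ i : ZMod m, i ≠ 0 ∧ i ≠ t ∧ i ≠ 2 * t ∧ 2 * i ≠ t ∧ 2 * i ≠ 2 * t ∧ 2 * i ≠ 3 * t) ∨
    ∃ i j : ZMod m, 2 * i = t ∧ 2 * j = t ∧ i ≠ 2 * t ∧ j ≠ 2 * t ∧
      i + j ≠ 0 ∧ i + j ≠ t ∧ i + j ≠ 2 * t := by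
  interval_cases m <;> revert t <;> decide

namespace IsRigidPair

variable {m : ℕ} {x : ZMod m → ℝ} {b c : ZMod m}

theorem eq_of_seven_le [NeZero m] (h : IsRigidPair m x b c) (hm : 7 ≤ m) : x b = x c := by
  classical
  by_contra hne
  have hlt : x b < x c := lt_of_le_of_ne h.le hne
  rcases h.relation_cases hlt with hb | ⟨hb, hxb⟩
  · have hc : c = 2 * b := by linear_combination hb
    have hcases := fun p hp hpb hpc => h.atom_cases_of_eq_left (p := p) hlt hb hp hpb hpc
    have hb0 := h.left_ne
    have hc0 : 2 * b ≠ 0 := hc ▸ h.right_ne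
    have hle : m ≤ 9 := by
      have h1 := le_card_add_six m {0, b, c} b (2 * b) (3 * b) fun p hp => by
        simp only [Finset.mem_insert, Finset.mem_singleton, not_or] at hp
        rcases hcases p hp.1 hp.2.1 hp.2.2 with h' | h' | h'
        · exact Or.inl h'.1
        · exact Or.inr (Or.inl h'.1)
        · exact Or.inr (Or.inr h')
      have h2 := Finset.card_le_three (a := (0 : ZMod m)) (b := b) (c := c)
      omega
    rcases exists_residue_of_left m hm hle b hb0 hc0 with
      ⟨i, h0, h1, h2, h3, h4, h5⟩ | ⟨i, j, hi, hj, hi2, hj2, hs0, hs1, hs2⟩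
    · rcases hcases i h0 h1 (hc ▸ h2) with h' | h' | h'
      · exact h3 h'.1
      · exact h4 h'.1
      · exact h5 h'
    · have hhalf : ∀ q : ZMod m, 2 * q = b → q ≠ 2 * b → q ≠ 0 ∧ 2 * x q = x b := by
        intro q hq hq2
        have hq0 : q ≠ 0 := by rintro rfl; exact hb0 (by simpa using hq.symm)
        have hqb : q ≠ b := by rintro rfl; exact hb0 (by linear_combination hq)
        rcases hcases q hq0 hqb (hc ▸ hq2) with h' | h' | h'
        · exact ⟨hq0, h'.2⟩
        · exact absurd (by linear_combination hq - h'.1) hb0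
        · exact absurd (by linear_combination hq - h') hc0
      obtain ⟨hi0, hxi⟩ := hhalf i hi hi2
      obtain ⟨hj0, hxj⟩ := hhalf j hj hj2
      have hs : 2 * (i + j) = 2 * b := by linear_combination hi + hj
      have hxs : 2 * x (i + j) = 2 * x b := by
        rcases hcases (i + j) hs0 hs1 (hc ▸ hs2) with h' | h' | h'
        · exact absurd (by linear_combination h'.1 - hs) hb0
        · exact h'.2
        · exact absurd (by linear_combination hs - h') hb0
      exact h.not_atom hi0 hj0 hs0 hs1 (hc ▸ hs2) rfl (by linarith)
  · obtain ⟨t, ht⟩ : ∃ t, c - b = t := ⟨_, rfl⟩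
    rw [ht] at hb hxb
    have hc : c = 3 * t := by linear_combination ht - hb
    have hcases := fun p hp hpb hpc hpt =>
      h.atom_cases_of_eq_double (p := p) hlt ht hb hxb hp hpb hpc hpt
    have hle : m ≤ 10 := by
      have h1 := le_card_add_six m {0, b, c, t} (2 * t) (3 * t) (4 * t) fun p hp => by
        simp only [Finset.mem_insert, Finset.mem_singleton, not_or] at hp
        exact hcases p hp.1 hp.2.1 hp.2.2.1 hp.2.2.2
      have h2 := Finset.card_le_four (a := (0 : ZMod m)) (b := b) (c := c) (d := t)
      omega
    obtain ⟨i, h0, h1, h2, h3, h4, h5, h6⟩ :=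
      exists_residue_of_double m hm hle t (hb ▸ h.left_ne) (hc ▸ h.right_ne)
    rcases hcases i h0 (hb ▸ h2) (hc ▸ h3) h1 with h' | h' | h'
    · exact h4 h'
    · exact h5 h'
    · exact h6 h'

/-- If `m` is odd and `x b = x c`, then `c - b` generates `ZMod m`. -/
theorem zmultiples_eq_top [NeZero m] (h : IsRigidPair m x b c) (hm : 7 ≤ m) (hodd : Odd m)
    (hxbc : x b = x c) : AddSubgroup.zmultiples (c - b) = ⊤ := by
  classical
  set H := AddSubgroup.zmultiples (c - b) with hH
  obtain ⟨n, hn⟩ := hodd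
  have hmem : ∀ p, p ≠ 0 → p ≠ b → p ≠ c → 2 * p - b ∈ H := by
    intro p hp hpb hpc
    rcases h.atom_cases hp hpb hpc with ⟨k, -, hk⟩ | ⟨hx, -⟩
    · refine AddSubgroup.mem_zmultiples_iff.mpr ⟨k, ?_⟩
      rw [zsmul_eq_mul]
      linear_combination -hk
    · have := h.pos _ h.sub_ne
      linarith
  let s : Finset (ZMod m) := Finset.univ \ {0, b, c}
  have hs : ∀ p, p ∈ s ↔ p ≠ 0 ∧ p ≠ b ∧ p ≠ c := by intro p; simp [s]
  have hcard : m ≤ s.card + 3 := by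
    have h1 := Finset.le_card_sdiff ({0, b, c} : Finset (ZMod m)) Finset.univ
    have h2 := Finset.card_le_three (a := (0 : ZMod m)) (b := b) (c := c)
    rw [Finset.card_univ, ZMod.card] at h1
    change m - _ ≤ s.card at h1
    omega
  obtain ⟨p₀, hp₀⟩ : s.Nonempty := Finset.card_pos.mp (by omega)
  have hdiff : ∀ p ∈ s, p - p₀ ∈ H := by
    intro p hp
    obtain ⟨h1, h2, h3⟩ := (hs p).mp hp
    obtain ⟨h4, h5, h6⟩ := (hs p₀).mp hp₀
    have h7 := H.nsmul_mem (H.sub_mem (hmem p h1 h2 h3) (hmem p₀ h4 h5 h6)) (n + 1)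
    have hm0 : (2 : ZMod m) * n + 1 = 0 := by
      have : ((2 * n + 1 : ℕ) : ZMod m) = 0 := by rw [← hn]; exact ZMod.natCast_self m
      exact_mod_cast this
    convert h7 using 1
    rw [nsmul_eq_mul]
    push_cast
    linear_combination -(p - p₀) * hm0
  have hle : s.card ≤ Nat.card H := by
    rw [Nat.card_eq_fintype_card, ← Fintype.card_coe]
    refine Fintype.card_le_of_injective (fun p : s => (⟨p.1 - p₀, hdiff p.1 p.2⟩ : H)) ?_
    intro p q hpq
    exact Subtype.ext (sub_left_inj.mp (congrArg Subtype.val hpq))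
  have hdvd := AddSubgroup.card_addSubgroup_dvd_card H
  rw [Nat.card_zmod] at hdvd
  refine AddSubgroup.eq_top_of_card_eq H ?_
  rw [Nat.card_zmod]
  obtain ⟨d, hd⟩ := hdvd
  have hd2 : d < 2 := by
    by_contra hn'
    have : Nat.card H * 2 ≤ Nat.card H * d := Nat.mul_le_mul_left _ (by omega)
    omega
  interval_cases d <;> omega

theorem not_odd [NeZero m] (h : IsRigidPair m x b c) (hm : 7 ≤ m) (hxbc : x b = x c) :
    ¬ Odd m := by
  classical
  intro hodd
  have : Fact (1 < m) := ⟨by omega⟩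
  obtain ⟨u, hu⟩ : ∃ u : ZMod m, u * (c - b) = 1 := by
    have h1 : (1 : ZMod m) ∈ AddSubgroup.zmultiples (c - b) := by
      rw [h.zmultiples_eq_top hm hodd hxbc]; trivial
    obtain ⟨k, hk⟩ := AddSubgroup.mem_zmultiples_iff.mp h1
    exact ⟨k, by rw [← hk, zsmul_eq_mul]⟩
  have hinj : ∀ i j, (u * i).val = (u * j).val → i = j := by
    intro i j hij
    have := ZMod.val_injective m hij
    linear_combination (c - b) * this - (i - j) * hu
  have hval0 : (u * 0).val = 0 := by simp
  set β := (u * b).val with hβ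
  have hβlt : β < m := ZMod.val_lt _
  have hc : (u * c).val = (β + 1) % m := by
    rw [show u * c = u * b + 1 by linear_combination hu, ZMod.val_add, ZMod.val_one]
  have hc' : (u * c).val = β + 1 := by
    rw [hc]
    refine Nat.mod_eq_of_lt (lt_of_le_of_ne hβlt fun h' => h.right_ne (hinj _ _ ?_))
    rw [hc, hval0, show β + 1 = m from h', Nat.mod_self]
  have hclt : (u * c).val < m := ZMod.val_lt _
  let f : ZMod m → ℝ := fun i =>
    ((u * i).val : ℝ) - (β + if (u * i).val < β then 0 else (m : ℝ)) / 2
  let v : ZMod m → ℝ := fun i => if i = b then 0 else if i = c then 1 else f i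
  have hvb : v b = 0 := by simp [v]
  have hvc : v c = 1 := by simp [v, h.ne.symm]
  have hv : ∀ i, i ≠ b → i ≠ c → v i = f i := fun i h1 h2 => by simp [v, h1, h2]
  have hf : ∀ i j, i ≠ 0 → i ≠ b → j ≠ 0 → j ≠ b → ∀ e : ℕ, e ≤ 1 → β + e < m →
      (u * (i + j)).val = β + e → f i + f j = e := by
    intro i j hi hib hj hjb e he hem hs
    rw [mul_add, ZMod.val_add] at hs
    have hk : (u * i).val < m := ZMod.val_lt _
    have hl : (u * j).val < m := ZMod.val_lt _
    have hk0 : (u * i).val ≠ 0 := fun h' => hi (hinj _ _ (by rw [h', hval0]))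
    have hl0 : (u * j).val ≠ 0 := fun h' => hj (hinj _ _ (by rw [h', hval0]))
    have hkb : (u * i).val ≠ β := fun h' => hib (hinj _ _ h')
    have hlb : (u * j).val ≠ β := fun h' => hjb (hinj _ _ h')
    simp only [f]
    generalize (u * i).val = k at *
    generalize (u * j).val = l at *
    rcases lt_or_ge (k + l) m with hlt | hge
    · rw [Nat.mod_eq_of_lt hlt] at hs
      rw [if_pos (by omega), if_pos (by omega)]
      have : (k : ℝ) + l = β + e := by exact_mod_cast hs
      linarith
    · rw [Nat.mod_eq_sub_mod hge, Nat.mod_eq_of_lt (by omega)] at hs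
      rw [if_neg (by omega), if_neg (by omega)]
      have : (k : ℝ) + l = β + e + m := by
        have : k + l = β + e + m := by omega
        exact_mod_cast this
      linarith
  have hsol := h.exists_eq_mul v
    (fun i j hi hib hic hj hjb hjc hs _ => by
      rw [hv i hib hic, hv j hjb hjc, hvb, hf i j hi hib hj hjb 0 (by omega) (by omega)
        (by rw [hs, ← hβ, add_zero])]
      simp)
    (fun i j hi hib hic hj hjb hjc hs _ => by
      rw [hv i hib hic, hv j hjb hjc, hvc, hf i j hi hib hj hjb 1 le_rfl (by omega)
        (by rw [hs, hc'])]
      simp)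
    (fun hx => by
      have := h.pos _ h.sub_ne
      linarith)
  have := h.eq_zero hsol hvb h.right_ne
  rw [hvc] at this
  exact one_ne_zero this

end IsRigidPair

/-- The two nonzero residues that are not atoms, ordered by their coordinates. -/
theorem exists_isRigidPair (m : ℕ) (hm : 7 ≤ m) [NeZero m] (x : ZMod m → ℝ)
    (hpos : ∀ i : ZMod m, i ≠ 0 → 0 < x i) (he : kunzE m x = m - 3) (hd : kunzD m x = 1) :
    ∃ b c, IsRigidPair m x b c := by
  classical
  have hcompl : ((insert 0 (KunzAtoms m x))ᶜ : Set (ZMod m)).ncard = 2 := by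
    have h1 := Set.ncard_add_ncard_compl (insert 0 (KunzAtoms m x))
    rw [Set.ncard_insert_of_notMem (fun h => h.1 rfl), Nat.card_zmod] at h1
    have : (KunzAtoms m x).ncard = m - 3 := he
    omega
  obtain ⟨b, c, hbc, hset⟩ := Set.ncard_eq_two.mp hcompl
  have key : ∀ b c, b ≠ c → (insert 0 (KunzAtoms m x))ᶜ = ({b, c} : Set (ZMod m)) →
      x b ≤ x c → IsRigidPair m x b c := by
    intro b c hbc hset hle
    have hb : b ∈ (insert 0 (KunzAtoms m x))ᶜ := by simp [hset]
    have hc : c ∈ (insert 0 (KunzAtoms m x))ᶜ := by simp [hset]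
    refine ⟨fun h => hb (Or.inl h), fun h => hc (Or.inl h), hbc, hpos, hle, ?_, fun v hv =>
      exists_eq_mul_of_kunzD_eq_one m (by omega) x hpos hd v hv⟩
    intro i j hi hj hs hsb hsc
    have : i + j ∈ KunzAtoms m x := by
      by_contra hn
      have : i + j ∈ (insert 0 (KunzAtoms m x))ᶜ := by simp [hs, hn]
      rw [hset] at this
      rcases this with h | h
      · exact hsb h
      · exact hsc h
    exact this.2 i j hi hj rfl
  rcases le_total (x b) (x c) with h | h
  · exact ⟨b, c, key b c hbc hset h⟩
  · exact ⟨c, b, key c b hbc.symm (by rw [hset, Set.pair_comm]) h⟩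

/-- For `m ≥ 7`: if `e(x) = m - 3` and `d(x) = 1`, then `m` is even and the face
containing `x` is not Apéry. -/
theorem not_apery_of_embdim_m_sub_three_dim_one (m : ℕ) (hm : 7 ≤ m) [NeZero m]
    (x : ZMod m → ℝ) (hx : x ∈ KunzCone m) (hpos : ∀ i : ZMod m, i ≠ 0 → 0 < x i)
    (he : kunzE m x = m - 3) (hd : kunzD m x = 1) :
    Even m ∧ ¬ ∃ y, IsAperyPoint m y ∧ EqualitySet m y = EqualitySet m x := by
  obtain ⟨b, c, h⟩ := exists_isRigidPair m hm x hpos he hd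
  have hbc := h.eq_of_seven_le hm
  refine ⟨Nat.not_odd_iff_even.mp (h.not_odd hm hbc), ?_⟩
  rintro ⟨y, ⟨-, hy⟩, hE⟩
  obtain ⟨r, hr⟩ := h.rigid y fun i j hij => by
    rw [← hE] at hij
    exact hij.2.2.2
  obtain ⟨z, hz, hzb⟩ := hy b h.left_ne
  obtain ⟨w, hw, hwc⟩ := hy c h.right_ne
  have hyy : y b = y c := by rw [hr b h.left_ne, hr c h.right_ne, hbc]
  have hzw : z = w := by
    rw [hz, hw] at hyy
    exact_mod_cast hyy
  exact h.ne (by rw [← hzb, ← hwc, hzw])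
end

section
/- Fix an integer m ≥ 7 and an integer d with ⌊(m−1)/2⌋ ≤ d ≤ m − 2. Then there exists a point x ∈ C_m all of whose coordinates are positive such that e(x) = m − 2 and d(x) = d. Moreover, if m is odd or d ≠ m/2 − 1, then x can be chosen so that additionally there exists an Apéry point y of C_m with E(y) = E(x). -/
open scoped BigOperators

/-- The pairs `(i, j)` of nonzero residues with `i + j = 2` at distance at most `k` from `1`. -/
def pairsNearOne (m k : ℕ) : Set (ZMod m × ZMod m) :=
  {p | p.1 ≠ 0 ∧ p.2 ≠ 0 ∧ p.1 + p.2 = 2 ∧ (p.1 - 1).valMinAbs.natAbs ≤ k}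

/-- The natural numbers `t ≤ k` different from `1`, which index the unordered pairs
`{1 + t, 1 - t}` occurring in `pairsNearOne m k`. -/
def radii (k : ℕ) : Finset ℕ := (Finset.range (k + 1)).erase 1

lemma mem_radii {k t : ℕ} : t ∈ radii k ↔ t ≠ 1 ∧ t ≤ k := by
  simp [radii]

lemma card_radii {k : ℕ} (hk : 1 ≤ k) : (radii k).card = k := by
  rw [radii, Finset.card_erase_of_mem (by simp; omega), Finset.card_range, Nat.add_sub_cancel]

section ZModCasts

variable {m : ℕ}

lemma natCast_zmod_inj {s t : ℕ} (hs : s < m) (ht : t < m) :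
    (s : ZMod m) = t ↔ s = t := by
  rw [ZMod.natCast_eq_natCast_iff', Nat.mod_eq_of_lt hs, Nat.mod_eq_of_lt ht]

lemma two_ne_zero_zmod (hm : 3 ≤ m) : (2 : ZMod m) ≠ 0 := by
  simpa using (natCast_zmod_inj (m := m) (s := 2) (t := 0) (by omega) (by omega)).not.2 (by omega)

lemma one_ne_zero_zmod (hm : 3 ≤ m) : (1 : ZMod m) ≠ 0 := by
  simpa using (natCast_zmod_inj (m := m) (s := 1) (t := 0) (by omega) (by omega)).not.2 (by omega)

lemma natAbs_valMinAbs_natCast {t : ℕ} (ht : 2 * t ≤ m) :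
    (t : ZMod m).valMinAbs.natAbs = t := by
  rw [ZMod.valMinAbs_natCast_of_le_half (by omega), Int.natAbs_natCast]

end ZModCasts

lemma mem_kunzAtoms_iff {m : ℕ} {x : ZMod m → ℝ} {a : ZMod m} :
    a ∈ KunzAtoms m x ↔ a ≠ 0 ∧ ∀ p ∈ EqualitySet m x, p.1 + p.2 ≠ a := by
  constructor
  · rintro ⟨ha, h⟩
    refine ⟨ha, ?_⟩
    rintro ⟨i, j⟩ ⟨hi, hj, -, hx⟩ rfl
    exact h i j hi hj rfl hx
  · rintro ⟨ha, h⟩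
    refine ⟨ha, ?_⟩
    rintro i j hi hj rfl hx
    exact h (i, j) ⟨hi, hj, ha, hx⟩ rfl

lemma kunzE_of_equalitySet {m k : ℕ} [NeZero m] (hm : 3 ≤ m) {x : ZMod m → ℝ}
    (hE : EqualitySet m x = pairsNearOne m k) : kunzE m x = m - 2 := by
  have h2 := two_ne_zero_zmod hm
  have h1 := one_ne_zero_zmod hm
  have hA : KunzAtoms m x = (({0, 2} : Finset (ZMod m))ᶜ : Finset (ZMod m)) := by
    ext a
    rw [mem_kunzAtoms_iff, hE]
    simp only [Finset.coe_compl, Set.mem_compl_iff, Finset.mem_coe, Finset.mem_insert,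
      Finset.mem_singleton, not_or]
    refine and_congr_right fun _ => ⟨?_, ?_⟩
    · rintro h rfl
      exact h (1, 1) ⟨h1, h1, one_add_one_eq_two, by simp⟩ one_add_one_eq_two
    · rintro ha p hp rfl
      exact ha hp.2.2.1
  rw [kunzE, hA, Set.ncard_coe_finset, Finset.card_compl, ZMod.card,
    Finset.card_pair h2.symm]

lemma linearIndependent_hypVec_radii {m k : ℕ} (hm : 3 ≤ m) (hk : 2 * k ≤ m) :
    LinearIndependent ℚ fun t : radii k => hypVec m (1 + (t : ℕ)) (1 - (t : ℕ)) := by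
  rw [Fintype.linearIndependent_iff]
  rintro g hg ⟨t, ht⟩
  obtain ⟨ht1, htk⟩ := mem_radii.1 ht
  have hval := congrFun hg (1 + (t : ZMod m))
  rw [Finset.sum_apply, Finset.sum_eq_single ⟨t, ht⟩] at hval
  · have h2 : (1 : ZMod m) + t ≠ 2 := by
      rw [← one_add_one_eq_two, Ne, add_right_inj]
      simpa using (natCast_zmod_inj (m := m) (s := t) (t := 1) (by omega) (by omega)).not.2 ht1
    have hpos : (0 : ℚ) < hypVec m (1 + (t : ℕ)) (1 - (t : ℕ)) (1 + (t : ZMod m)) := by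
      simp only [hypVec, Pi.sub_apply, Pi.add_apply, Pi.single_apply, if_true]
      rw [if_neg (show ¬(1 + (t : ZMod m) = 1 + t + (1 - t)) by
        rwa [add_add_sub_cancel, one_add_one_eq_two])]
      split_ifs <;> norm_num
    simpa [hpos.ne'] using hval
  · rintro ⟨s, hs⟩ - hst
    obtain ⟨hs1, hsk⟩ := mem_radii.1 hs
    have hst : s ≠ t := fun h => hst (Subtype.ext h)
    have h2 : (t : ZMod m) ≠ 1 := by
      simpa using (natCast_zmod_inj (m := m) (s := t) (t := 1) (by omega) (by omega)).not.2 ht1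
    have h3 : (1 : ZMod m) + t ≠ 1 + s := by
      rw [Ne, add_right_inj, natCast_zmod_inj (by omega) (by omega)]
      exact hst.symm
    have h4 : (1 : ZMod m) + t ≠ 1 - s := by
      rw [Ne, sub_eq_add_neg, add_right_inj]
      intro h
      have := congrArg (fun z : ZMod m => z.valMinAbs.natAbs) h
      simp only [ZMod.natAbs_valMinAbs_neg] at this
      rw [natAbs_valMinAbs_natCast (by omega), natAbs_valMinAbs_natCast (by omega)] at this
      exact hst this.symm
    simp [hypVec, h2, h3, h4]
  · simp

lemma setOf_hypVec_pairsNearOne {m k : ℕ} [NeZero m] (hm : 3 ≤ m) (hk : 2 * k ≤ m) :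
    {v : ZMod m → ℚ | ∃ p ∈ pairsNearOne m k, v = hypVec m p.1 p.2} =
      Set.range fun t : radii k => hypVec m (1 + (t : ℕ)) (1 - (t : ℕ)) := by
  ext v
  simp only [Set.mem_ofPred_eq, Set.mem_range, Subtype.exists, Prod.exists]
  constructor
  · rintro ⟨i, j, ⟨hi, hj, hij, hik⟩, rfl⟩
    simp only at hi hj hij hik
    obtain rfl : j = 2 - i := eq_sub_of_add_eq' hij
    refine ⟨(i - 1).valMinAbs.natAbs, mem_radii.2 ⟨fun h => ?_, hik⟩, ?_⟩
    · have hi1 := ZMod.coe_valMinAbs (i - 1)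
      rcases Int.natAbs_eq_iff.1 h with h | h <;> rw [h] at hi1 <;> push_cast at hi1
      · exact hj (by linear_combination hi1)
      · exact hi (by linear_combination -hi1)
    · have hi1 := ZMod.coe_valMinAbs (i - 1)
      generalize (i - 1).valMinAbs = z at hi1
      rcases Int.natAbs_eq z with h | h <;> generalize z.natAbs = t at h <;> subst h <;>
        push_cast at hi1
      · congr 1
        · linear_combination hi1
        · linear_combination -hi1
      · have e1 : 1 + (t : ZMod m) = 2 - i := by linear_combination -hi1
        have e2 : 1 - (t : ZMod m) = i := by linear_combination hi1
        rw [e1, e2, hypVec, hypVec, add_comm (2 - i) i, add_comm (Pi.single (2 - i) 1)]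
  · rintro ⟨t, ht, rfl⟩
    obtain ⟨ht1, htk⟩ := mem_radii.1 ht
    refine ⟨_, _, ⟨?_, ?_, ?_, ?_⟩, rfl⟩
    · have := (natCast_zmod_inj (m := m) (s := 1 + t) (t := 0) (by omega) (by omega)).not.2
        (by omega)
      simpa using this
    · have := (natCast_zmod_inj (m := m) (s := 1) (t := t) (by omega) (by omega)).not.2
        ht1.symm
      simpa [sub_eq_zero] using this
    · simp only; ring
    · simp only [add_sub_cancel_left]
      rwa [natAbs_valMinAbs_natCast (by omega)]

lemma kunzD_of_equalitySet {m k : ℕ} [NeZero m] (hm : 3 ≤ m) (hk1 : 1 ≤ k) (hk : 2 * k ≤ m)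
    {x : ZMod m → ℝ} (hE : EqualitySet m x = pairsNearOne m k) : kunzD m x = m - 1 - k := by
  rw [kunzD, hE, setOf_hypVec_pairsNearOne hm hk,
    finrank_span_eq_card (linearIndependent_hypVec_radii hm hk), Fintype.card_coe, card_radii hk1]

/-- If all coordinates of `x` other than `x 2` lie in a range `[L, 2 * L)`, then only the
inequalities with `i + j = 2` can be tight. -/
lemma mem_kunzCone_and_equalitySet {m k : ℕ} (hm : 3 ≤ m) {x : ZMod m → ℝ} (L : ℝ)
    (hL : ∀ i, L ≤ x i) (hU : ∀ i, i ≠ 2 → x i < 2 * L)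
    (hle : ∀ i j, i ≠ 0 → j ≠ 0 → i + j = 2 → x 2 ≤ x i + x j)
    (heq : ∀ i j, i ≠ 0 → j ≠ 0 → i + j = 2 →
      (x i + x j = x 2 ↔ (i - 1).valMinAbs.natAbs ≤ k)) :
    x ∈ KunzCone m ∧ EqualitySet m x = pairsNearOne m k := by
  constructor
  · intro i j hi hj _
    by_cases h : i + j = 2
    · rw [h]; exact hle i j hi hj h
    · linarith [hL i, hL j, hU _ h]
  · ext ⟨i, j⟩
    constructor
    · rintro ⟨hi, hj, _, hx⟩
      have h : i + j = 2 := by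
        by_contra h
        simp only at hx
        linarith [hL i, hL j, hU _ h]
      exact ⟨hi, hj, h, (heq i j hi hj h).1 (by simpa [h] using hx)⟩
    · rintro ⟨hi, hj, h, hk⟩
      simp only at hi hj h hk
      refine ⟨hi, hj, ?_, ?_⟩ <;> simp only [h]
      · exact two_ne_zero_zmod hm
      · exact (heq i j hi hj h).2 hk

lemma exists_mem_kunzCone_of_two_mul_eq {m k : ℕ} [NeZero m] (hm : 3 ≤ m) (hk : 2 * k = m) :
    ∃ x : ZMod m → ℝ, x ∈ KunzCone m ∧ (∀ i, i ≠ 0 → 0 < x i) ∧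
      EqualitySet m x = pairsNearOne m k := by
  have key : ∀ i j : ZMod m, i ≠ 0 → j ≠ 0 → i + j = 2 → i ≠ 2 ∧ j ≠ 2 := by
    rintro i j hi hj h
    refine ⟨?_, ?_⟩ <;> rintro rfl <;> simp_all
  obtain ⟨hC, hE⟩ := mem_kunzCone_and_equalitySet (k := k) hm
    (x := fun i : ZMod m => if i = 2 then (2 : ℝ) else 1) 1
    (fun i => by split_ifs <;> norm_num) (fun i hi => by simp [hi])
    (fun i j hi hj h => by simp [key i j hi hj h]; norm_num)
    (fun i j hi hj h => by
      have := ZMod.natAbs_valMinAbs_le (i - 1)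
      have : (i - 1).valMinAbs.natAbs ≤ k := by omega
      simp [key i j hi hj h, this]; norm_num)
  exact ⟨_, hC, fun i _ => by split_ifs <;> norm_num, hE⟩

/-- An integer lift of the residues, with `aperyLift m k i + aperyLift m k j = aperyLift m k 2`
for all `(i, j)` in `pairsNearOne m k`. -/
def aperyLift (m k : ℕ) (i : ZMod m) : ℤ :=
  if i = 2 then 2 + 6 * m
  else if (i - 1).valMinAbs.natAbs ≤ k then 1 + (i - 1).valMinAbs + 3 * m
  else 1 + (i - 1).valMinAbs + 4 * m

lemma aperyLift_cast {m k : ℕ} (i : ZMod m) : (aperyLift m k i : ZMod m) = i := by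
  unfold aperyLift
  split_ifs with h <;> push_cast [ZMod.natCast_self, ZMod.coe_valMinAbs]
  · rw [h]; ring
  · ring
  · ring

lemma exists_isAperyPoint {m k : ℕ} [NeZero m] (hm : 3 ≤ m) (hk : 2 * k < m) :
    ∃ x : ZMod m → ℝ, x ∈ KunzCone m ∧ (∀ i, i ≠ 0 → 0 < x i) ∧
      EqualitySet m x = pairsNearOne m k ∧ IsAperyPoint m x := by
  have bound : ∀ i : ZMod m, -(m : ℤ) < (i - 1).valMinAbs * 2 ∧ (i - 1).valMinAbs * 2 ≤ m :=
    fun i => ZMod.valMinAbs_mem_Ioc (i - 1)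
  have lower : ∀ i : ZMod m, 5 * (m : ℤ) + 2 ≤ 2 * aperyLift m k i := by
    intro i
    have := bound i
    unfold aperyLift
    split_ifs <;> omega
  have upper : ∀ i : ZMod m, i ≠ 2 → aperyLift m k i < 5 * (m : ℤ) + 2 := by
    intro i hi
    have := bound i
    rw [aperyLift, if_neg hi]
    split_ifs <;> omega
  have pair : ∀ i j : ZMod m, i ≠ 0 → j ≠ 0 → i + j = 2 →
      aperyLift m k 2 ≤ aperyLift m k i + aperyLift m k j ∧
      (aperyLift m k i + aperyLift m k j = aperyLift m k 2 ↔
        (i - 1).valMinAbs.natAbs ≤ k) := by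
    intro i j hi hj h
    have hi2 : i ≠ 2 := by rintro rfl; simp_all
    have hj2 : j ≠ 2 := by rintro rfl; simp_all
    have hneg : j - 1 = -(i - 1) := by linear_combination h
    have habs : (j - 1).valMinAbs.natAbs = (i - 1).valMinAbs.natAbs := by
      rw [hneg, ZMod.natAbs_valMinAbs_neg]
    have hbi := bound i
    have hbj := bound j
    have h2 : aperyLift m k 2 = 2 + 6 * m := if_pos rfl
    rw [h2, aperyLift, aperyLift, if_neg hi2, if_neg hj2, habs]
    split_ifs with hle
    · have : (j - 1).valMinAbs = -(i - 1).valMinAbs := by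
        rw [ZMod.valMinAbs_spec]
        refine ⟨by rw [hneg]; push_cast [ZMod.coe_valMinAbs]; ring, ?_, ?_⟩ <;> omega
      refine ⟨by omega, by omega⟩
    · refine ⟨by omega, by omega⟩
  obtain ⟨hC, hE⟩ := mem_kunzCone_and_equalitySet (k := k) hm
    (x := fun i : ZMod m => (aperyLift m k i : ℝ)) ((5 * m + 2) / 2)
    (fun i => by have : (5 * m + 2 : ℝ) ≤ 2 * aperyLift m k i := mod_cast lower i
                 linarith)
    (fun i hi => by have : (aperyLift m k i : ℝ) < 5 * m + 2 := mod_cast upper i hi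
                    linarith)
    (fun i j hi hj h => mod_cast (pair i j hi hj h).1)
    (fun i j hi hj h => mod_cast (pair i j hi hj h).2)
  refine ⟨_, hC, fun i _ => ?_, hE, hC, fun i _ => ⟨_, rfl, aperyLift_cast i⟩⟩
  have := lower i
  exact Int.cast_pos.2 (by omega)

/-- For `m ≥ 7` and `⌊(m-1)/2⌋ ≤ d ≤ m - 2` there is a face of `C_m` with `e(F) = m - 2`
and `d(F) = d`; moreover if `m` is odd or `d ≠ m/2 - 1`, such a face can be chosen
Apéry. -/
theorem exists_face_embdim_m_sub_two (m : ℕ) (hm : 7 ≤ m) [NeZero m] (d : ℕ)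
    (hd1 : (m - 1) / 2 ≤ d) (hd2 : d ≤ m - 2) :
    (∃ x : ZMod m → ℝ, x ∈ KunzCone m ∧ (∀ i : ZMod m, i ≠ 0 → 0 < x i) ∧
      kunzE m x = m - 2 ∧ kunzD m x = d) ∧
    ((Odd m ∨ m ≠ 2 * (d + 1)) →
      ∃ x : ZMod m → ℝ, x ∈ KunzCone m ∧ (∀ i : ZMod m, i ≠ 0 → 0 < x i) ∧
        kunzE m x = m - 2 ∧ kunzD m x = d ∧
        ∃ y, IsAperyPoint m y ∧ EqualitySet m y = EqualitySet m x) := by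
  have hk2 : 2 * (m - 1 - d) ≤ m := by omega
  have hsize : ∀ x : ZMod m → ℝ, EqualitySet m x = pairsNearOne m (m - 1 - d) →
      kunzE m x = m - 2 ∧ kunzD m x = d := fun x hE =>
    ⟨kunzE_of_equalitySet (by omega) hE, by
      rw [kunzD_of_equalitySet (by omega) (by omega) hk2 hE]; omega⟩
  rcases hk2.lt_or_eq with hlt | heq
  · obtain ⟨x, hC, hpos, hE, hA⟩ := exists_isAperyPoint (by omega) hlt
    obtain ⟨he, hd⟩ := hsize x hE
    exact ⟨⟨x, hC, hpos, he, hd⟩, fun _ => ⟨x, hC, hpos, he, hd, x, hA, rfl⟩⟩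
  · obtain ⟨x, hC, hpos, hE⟩ := exists_mem_kunzCone_of_two_mul_eq (by omega) heq
    obtain ⟨he, hd⟩ := hsize x hE
    refine ⟨⟨x, hC, hpos, he, hd⟩, fun h => ?_⟩
    rcases h with ⟨c, hc⟩ | h <;> omega
end

section
/- Fix an integer m ≥ 7 and integers e and d with 2 ≤ e ≤ m − 3 and 2 ≤ d ≤ e. Then there exist a point x ∈ C_m all of whose coordinates are positive and an Apéry point y of C_m with E(y) = E(x), such that e(x) = e and d(x) = d. -/
open scoped BigOperators

/-- The ceiling of `n / u`. -/
def divCeil (u n : ℕ) : ℕ := (n + u - 1) / u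

theorem divCeil_mono (u : ℕ) : Monotone (divCeil u) := fun a b h =>
  Nat.div_le_div_right (by omega)

theorem divCeil_add_self {u : ℕ} (hu : 0 < u) (n : ℕ) : divCeil u (n + u) = divCeil u n + 1 := by
  unfold divCeil
  rw [show n + u + u - 1 = n + u - 1 + u by omega, Nat.add_div_right _ hu]

theorem divCeil_eq_one {u n : ℕ} (hn : 1 ≤ n) (hnu : n ≤ u) : divCeil u n = 1 := by
  unfold divCeil
  rw [Nat.div_eq_iff (by omega)]
  omega

theorem divCeil_pos {u n : ℕ} (hu : 0 < u) (hn : 1 ≤ n) : 1 ≤ divCeil u n := by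
  rw [← divCeil_eq_one le_rfl hu]
  exact divCeil_mono u hn

theorem divCeil_add_le {u : ℕ} (hu : 0 < u) (a b : ℕ) :
    divCeil u (a + b) ≤ divCeil u a + divCeil u b := by
  unfold divCeil
  have ha := Nat.div_add_mod (a + u - 1) u
  have hb := Nat.div_add_mod (b + u - 1) u
  have ha' := Nat.mod_lt (a + u - 1) hu
  have hb' := Nat.mod_lt (b + u - 1) hu
  rw [← Nat.lt_succ_iff, Nat.div_lt_iff_lt_mul hu]
  nlinarith [Nat.sub_add_cancel (show 1 ≤ a + u by omega),
    Nat.sub_add_cancel (show 1 ≤ b + u by omega),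
    Nat.sub_add_cancel (show 1 ≤ a + b + u by omega)]

/-- The value at `n` of the Apéry point: on `[1, k]` it is `n + m (n + ⌈n / u⌉)`, and its Kunz
coordinate is constant on `[k, m)`. -/
def aperyValue (m u k n : ℕ) : ℕ := n + m * (min n k + divCeil u (min n k))

section aperyValue

variable {m u k a b : ℕ}

theorem aperyValue_strictMono (m u k : ℕ) : StrictMono (aperyValue m u k) := by
  intro a b h
  have h1 : min a k ≤ min b k := by omega
  exact Nat.add_lt_add_of_lt_of_le h
    (Nat.mul_le_mul_left _ (Nat.add_le_add h1 (divCeil_mono u h1)))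

theorem aperyValue_add_lt (hm : 0 < m) (hu : 0 < u) (hk : 0 < k) (ha : 1 ≤ a) (hb : 1 ≤ b)
    (hab : k < a + b) : aperyValue m u k (a + b) < aperyValue m u k a + aperyValue m u k b := by
  have key : min (a + b) k + divCeil u (min (a + b) k) <
      (min a k + divCeil u (min a k)) + (min b k + divCeil u (min b k)) := by
    rw [min_eq_right hab.le]
    rcases le_total k a with h | h
    · rw [min_eq_right h]; omega
    rcases le_total k b with h' | h'
    · rw [min_eq_right h']; omega
    rw [min_eq_left h, min_eq_left h']
    have := divCeil_add_le hu a b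
    have := divCeil_mono u hab.le
    omega
  have := Nat.mul_lt_mul_of_pos_left key hm
  unfold aperyValue
  rw [mul_add m (min a k + divCeil u (min a k))] at this
  omega

theorem aperyValue_add_of_le (hab : a + b ≤ k) :
    aperyValue m u k a + aperyValue m u k b + m * divCeil u (a + b) =
      aperyValue m u k (a + b) + m * (divCeil u a + divCeil u b) := by
  unfold aperyValue
  rw [min_eq_left hab, min_eq_left (by omega : a ≤ k), min_eq_left (by omega : b ≤ k)]
  ring

theorem aperyValue_add_le (hm : 0 < m) (hu : 0 < u) (hk : 0 < k) (ha : 1 ≤ a) (hb : 1 ≤ b) :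
    aperyValue m u k (a + b) ≤ aperyValue m u k a + aperyValue m u k b := by
  rcases lt_or_ge k (a + b) with h | h
  · exact (aperyValue_add_lt hm hu hk ha hb h).le
  have h1 := aperyValue_add_of_le (m := m) (u := u) h
  have h2 := Nat.mul_le_mul_left m (divCeil_add_le hu a b)
  omega

theorem aperyValue_add_eq_iff (hm : 0 < m) (hu : 0 < u) (hk : 0 < k) (ha : 1 ≤ a) (hb : 1 ≤ b) :
    aperyValue m u k a + aperyValue m u k b = aperyValue m u k (a + b) ↔
      a + b ≤ k ∧ divCeil u a + divCeil u b = divCeil u (a + b) := by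
  rcases lt_or_ge k (a + b) with h | h
  · have := aperyValue_add_lt hm hu hk ha hb h
    omega
  have h1 := aperyValue_add_of_le (m := m) (u := u) h
  refine ⟨fun h2 => ⟨h, Nat.eq_of_mul_eq_mul_left hm (by omega)⟩, fun h2 => ?_⟩
  rw [h2.2] at h1
  omega

end aperyValue

theorem one_le_val {m : ℕ} {i : ZMod m} (hi : i ≠ 0) : 1 ≤ i.val :=
  Nat.one_le_iff_ne_zero.mpr ((ZMod.val_ne_zero i).mpr hi)

/-- The point of the Kunz cone with coordinates `aperyValue`. -/
def aperyPoint (m u k : ℕ) (i : ZMod m) : ℝ := (aperyValue m u k i.val : ℝ)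

theorem aperyPoint_pos {m u k : ℕ} {i : ZMod m} (hi : i ≠ 0) : 0 < aperyPoint m u k i := by
  unfold aperyPoint aperyValue
  have := one_le_val hi
  exact_mod_cast Nat.add_pos_left (by omega) _

section aperyPoint

variable {m u k : ℕ} [NeZero m]

theorem aperyPoint_add_lt_of_le {i j : ZMod m} (h : m ≤ i.val + j.val) :
    aperyPoint m u k (i + j) < aperyPoint m u k i + aperyPoint m u k j := by
  unfold aperyPoint
  have h1 := ZMod.val_add_val_of_le h
  have h2 := ZMod.val_lt j
  have h3 := aperyValue_strictMono m u k (show (i + j).val < i.val by omega)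
  exact_mod_cast Nat.lt_add_right _ h3

theorem aperyPoint_mem_kunzCone (hu : 0 < u) (hk : 0 < k) : aperyPoint m u k ∈ KunzCone m := by
  intro i j hi hj _
  rcases lt_or_ge (i.val + j.val) m with h | h
  · unfold aperyPoint
    rw [ZMod.val_add_of_lt h]
    exact_mod_cast aperyValue_add_le (NeZero.pos m) hu hk (one_le_val hi) (one_le_val hj)
  · exact (aperyPoint_add_lt_of_le h).le

theorem isAperyPoint_aperyPoint (hu : 0 < u) (hk : 0 < k) : IsAperyPoint m (aperyPoint m u k) :=
  ⟨aperyPoint_mem_kunzCone hu hk, fun i _ => ⟨aperyValue m u k i.val, by simp [aperyPoint], by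
    simp [aperyValue]⟩⟩

theorem mem_equalitySet_aperyPoint_iff (hu : 0 < u) (hk : 0 < k) (hkm : k < m) (i j : ZMod m) :
    (i, j) ∈ EqualitySet m (aperyPoint m u k) ↔ 1 ≤ i.val ∧ 1 ≤ j.val ∧ i.val + j.val ≤ k ∧
      divCeil u i.val + divCeil u j.val = divCeil u (i.val + j.val) := by
  have key (hi : 1 ≤ i.val) (hj : 1 ≤ j.val) (h : i.val + j.val < m) :
      aperyPoint m u k i + aperyPoint m u k j = aperyPoint m u k (i + j) ↔ i.val + j.val ≤ k ∧
        divCeil u i.val + divCeil u j.val = divCeil u (i.val + j.val) := by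
    rw [← aperyValue_add_eq_iff (NeZero.pos m) hu hk hi hj]
    unfold aperyPoint
    rw [ZMod.val_add_of_lt h]
    norm_cast
  constructor
  · rintro ⟨hi, hj, -, h⟩
    have hlt : i.val + j.val < m := by
      by_contra! hle
      exact (aperyPoint_add_lt_of_le hle).ne' h
    exact ⟨one_le_val hi, one_le_val hj, (key (one_le_val hi) (one_le_val hj) hlt).mp h⟩
  · rintro ⟨hi, hj, h⟩
    have hlt : i.val + j.val < m := by omega
    refine ⟨?_, ?_, ?_, (key hi hj hlt).mpr h⟩
    · rintro rfl; simp at hi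
    · rintro rfl; simp at hj
    · rw [← ZMod.val_ne_zero, ZMod.val_add_of_lt hlt]
      show i.val + j.val ≠ 0
      omega

theorem mem_kunzAtoms_aperyPoint_iff (hu : 0 < u) (hk : 0 < k) (hkm : k < m) (a : ZMod m) :
    a ∈ KunzAtoms m (aperyPoint m u k) ↔ 1 ≤ a.val ∧ (a.val ≤ u ∨ k < a.val) := by
  constructor
  · rintro ⟨ha, h⟩
    refine ⟨one_le_val ha, ?_⟩
    by_contra! hc
    have hval (n : ℕ) (hn : n < m) : (n : ZMod m).val = n := ZMod.val_cast_of_lt hn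
    have hu' := hval u (by omega)
    have hau := hval (a.val - u) (by omega)
    have hsum : ((a.val - u : ℕ) : ZMod m) + (u : ZMod m) = a := by
      rw [← Nat.cast_add, Nat.sub_add_cancel hc.1.le, ZMod.natCast_zmod_val]
    have hmem : (((a.val - u : ℕ) : ZMod m), (u : ZMod m)) ∈
        EqualitySet m (aperyPoint m u k) := by
      rw [mem_equalitySet_aperyPoint_iff hu hk hkm, hu', hau, divCeil_add_self hu,
        divCeil_eq_one hu le_rfl]
      omega
    refine h _ _ hmem.1 hmem.2.1 hsum ?_
    have := hmem.2.2.2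
    rwa [hsum] at this
  · rintro ⟨ha, h⟩
    have ha0 : a ≠ 0 := by rintro rfl; simp at ha
    refine ⟨ha0, fun i j hi hj hij heq => ?_⟩
    obtain ⟨hi', hj', hle, hc⟩ := (mem_equalitySet_aperyPoint_iff hu hk hkm i j).mp
      ⟨hi, hj, hij ▸ ha0, hij ▸ heq⟩
    have hval : a.val = i.val + j.val := by rw [← hij, ZMod.val_add_of_lt (by omega)]
    rcases h with h | h
    · rw [divCeil_eq_one hi' (by omega), divCeil_eq_one hj' (by omega),
        divCeil_eq_one (by omega) (by omega)] at hc
      omega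
    · omega

theorem kunzE_aperyPoint (hu : 0 < u) (huk : u ≤ k) (hkm : k < m) :
    kunzE m (aperyPoint m u k) = u + (m - 1 - k) := by
  have himage : KunzAtoms m (aperyPoint m u k) =
      (fun n : ℕ => (n : ZMod m)) '' ↑(Finset.Icc 1 u ∪ Finset.Ioo k m) := by
    ext a
    rw [mem_kunzAtoms_aperyPoint_iff hu (by omega) hkm]
    simp only [Set.mem_image, Finset.coe_union, Finset.coe_Icc, Finset.coe_Ioo, Set.mem_union,
      Set.mem_Icc, Set.mem_Ioo]
    constructor
    · intro h
      have := ZMod.val_lt a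
      exact ⟨a.val, by omega, ZMod.natCast_zmod_val a⟩
    · rintro ⟨n, hn, rfl⟩
      rw [ZMod.val_cast_of_lt (by omega)]
      omega
  have hinj : Set.InjOn (fun n : ℕ => (n : ZMod m))
      ↑(Finset.Icc 1 u ∪ Finset.Ioo k m) := by
    intro a ha b hb hab
    simp only [Finset.coe_union, Finset.coe_Icc, Finset.coe_Ioo, Set.mem_union,
      Set.mem_Icc, Set.mem_Ioo] at ha hb
    have := congrArg ZMod.val hab
    simp only at this
    rwa [ZMod.val_cast_of_lt (by omega), ZMod.val_cast_of_lt (by omega)] at this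
  rw [kunzE, himage, hinj.ncard_image, Set.ncard_coe_finset,
    Finset.card_union_of_disjoint, Nat.card_Icc, Nat.card_Ioo]
  · omega
  · rw [Finset.disjoint_left]
    intro n
    simp only [Finset.mem_Icc, Finset.mem_Ioo]
    omega

end aperyPoint

/-- The standard basis vector at the residue of `n`. -/
def stdVec (m n : ℕ) : ZMod m → ℚ := Pi.single (n : ZMod m) 1

/-- The difference between the basis vector at `n` and its expression through the basis vectors
at `1` and `2` modulo the relations of `aperyPoint`. -/
def relVec (m u n : ℕ) : ZMod m → ℚ :=
  stdVec m n - (divCeil u n : ℚ) • stdVec m 1 -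
    ((n : ℚ) - divCeil u n) • (stdVec m 2 - stdVec m 1)

theorem relVec_one {m u : ℕ} (hu : 0 < u) : relVec m u 1 = 0 := by
  simp [relVec, divCeil_eq_one le_rfl hu]

theorem relVec_two {m u : ℕ} (hu : 2 ≤ u) : relVec m u 2 = 0 := by
  simp only [relVec, divCeil_eq_one one_le_two hu]
  norm_num

theorem relVec_add {m u a b : ℕ} (h : divCeil u a + divCeil u b = divCeil u (a + b)) :
    relVec m u a + relVec m u b - relVec m u (a + b) =
      stdVec m a + stdVec m b - stdVec m (a + b) := by
  simp only [relVec, ← h]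
  push_cast
  module

theorem relVec_apply {m u k : ℕ} (hkm : k < m) (a b : Fin (k - 2)) :
    relVec m u (a + 3) ((b + 3 : ℕ) : ZMod m) = if a = b then 1 else 0 := by
  have hne {x y : ℕ} (hx : x < m) (hy : y < m) : (x : ZMod m) = y ↔ x = y := by
    constructor
    · intro h
      have := congrArg ZMod.val h
      rwa [ZMod.val_cast_of_lt hx, ZMod.val_cast_of_lt hy] at this
    · rintro rfl; rfl
  have hstd (x : ℕ) (hx : x < m) :
      stdVec m x ((b + 3 : ℕ) : ZMod m) = if b + 3 = x then 1 else 0 := by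
    simp only [stdVec, Pi.single_apply, hne (by omega : (b : ℕ) + 3 < m) hx]
  simp only [relVec, Pi.sub_apply, Pi.smul_apply]
  have := b.isLt
  rw [hstd _ (by omega), hstd 1 (by omega), hstd 2 (by omega)]
  simp [Fin.ext_iff, eq_comm]

section dimension

variable {m u k : ℕ} [NeZero m]

/-- The span of the normal vectors of the face of `aperyPoint`. -/
def relSpan (m u k : ℕ) : Submodule ℚ (ZMod m → ℚ) :=
  Submodule.span ℚ {v | ∃ p ∈ EqualitySet m (aperyPoint m u k), v = hypVec m p.1 p.2}

theorem stdVec_add_sub_mem_relSpan (hu : 0 < u) (hkm : k < m) {a b : ℕ} (ha : 1 ≤ a)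
    (hb : 1 ≤ b) (hab : a + b ≤ k) (h : divCeil u a + divCeil u b = divCeil u (a + b)) :
    stdVec m a + stdVec m b - stdVec m (a + b) ∈ relSpan m u k := by
  refine Submodule.subset_span ⟨((a : ZMod m), (b : ZMod m)), ?_, ?_⟩
  · rw [mem_equalitySet_aperyPoint_iff hu (by omega) hkm, ZMod.val_cast_of_lt (by omega),
      ZMod.val_cast_of_lt (by omega)]
    exact ⟨ha, hb, hab, h⟩
  · simp [hypVec, stdVec]

theorem relVec_add_sub_mem_relSpan (hu : 0 < u) (hkm : k < m) {a b : ℕ} (ha : 1 ≤ a)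
    (hb : 1 ≤ b) (hab : a + b ≤ k) (h : divCeil u a + divCeil u b = divCeil u (a + b)) :
    relVec m u a + relVec m u b - relVec m u (a + b) ∈ relSpan m u k := by
  rw [relVec_add h]
  exact stdVec_add_sub_mem_relSpan hu hkm ha hb hab h

theorem relVec_mem_relSpan_of_le (hu : 2 ≤ u) (huk : u + 2 ≤ k) (hkm : k < m) {n : ℕ}
    (hn : 1 ≤ n) (hnu : n ≤ u) : relVec m u n ∈ relSpan m u k := by
  have hsum {a b c : ℕ} (hc : a + b = u + c) (ha : 1 ≤ a) (hau : a ≤ u) (hb : 1 ≤ b)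
      (hbu : b ≤ u) (hc1 : 1 ≤ c) (hc2 : c ≤ 2) :
      relVec m u a + relVec m u b - relVec m u (u + c) ∈ relSpan m u k := by
    rw [← hc]
    refine relVec_add_sub_mem_relSpan (by omega) hkm ha hb (by omega) ?_
    rw [hc, add_comm u c, divCeil_add_self (by omega), divCeil_eq_one ha hau,
      divCeil_eq_one hb hbu, divCeil_eq_one hc1 (by omega)]
  have hstep {a : ℕ} (ha : 1 ≤ a) (hau : a + 1 ≤ u) :
      relVec m u (a + 1) - relVec m u a - (relVec m u (u + 2) - relVec m u (u + 1)) ∈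
        relSpan m u k := by
    have h1 := hsum (a := a) (b := u + 1 - a) (c := 1) (by omega) ha (by omega) (by omega)
      (by omega) le_rfl one_le_two
    have h2 := hsum (a := a + 1) (b := u + 1 - a) (c := 2) (by omega) (by omega) (by omega)
      (by omega) (by omega) one_le_two le_rfl
    convert sub_mem h2 h1 using 1
    abel
  have hdiff : relVec m u (u + 2) - relVec m u (u + 1) ∈ relSpan m u k := by
    have := hstep le_rfl hu
    rwa [relVec_two hu, relVec_one (by omega), sub_zero, zero_sub, neg_mem_iff] at this
  induction n, hn using Nat.le_induction with
  | base => rw [relVec_one (by omega)]; exact zero_mem _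
  | succ a ha ih =>
    convert add_mem (add_mem (hstep ha hnu) hdiff) (ih (by omega)) using 1
    abel

theorem relVec_mem_relSpan (hu : 2 ≤ u) (huk : u + 2 ≤ k) (hkm : k < m) {n : ℕ}
    (hn : 1 ≤ n) (hnk : n ≤ k) : relVec m u n ∈ relSpan m u k := by
  induction n using Nat.strong_induction_on with
  | _ n ih =>
    rcases le_or_gt n u with h | h
    · exact relVec_mem_relSpan_of_le hu huk hkm hn h
    obtain ⟨r, rfl⟩ := Nat.exists_eq_add_of_lt h
    have hr := ih (r + 1) (by omega) (by omega) (by omega)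
    have hself := relVec_mem_relSpan_of_le hu huk hkm (by omega : 1 ≤ u) le_rfl
    have hrel := relVec_add_sub_mem_relSpan (u := u) (by omega) hkm (a := r + 1) (b := u)
      (by omega) (by omega) (by omega)
      (by rw [divCeil_add_self (by omega), divCeil_eq_one (by omega : 1 ≤ u) le_rfl])
    rw [show r + 1 + u = u + r + 1 by ring] at hrel
    convert sub_mem (add_mem hr hself) hrel using 1
    abel

theorem relSpan_eq_span_range (hu : 2 ≤ u) (huk : u + 2 ≤ k) (hkm : k < m) :
    relSpan m u k = Submodule.span ℚ (Set.range fun n : Fin (k - 2) => relVec m u (n + 3)) := by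
  apply le_antisymm
  · have hmem (n : ℕ) (hn : 1 ≤ n) (hnk : n ≤ k) : relVec m u n ∈
        Submodule.span ℚ (Set.range fun n : Fin (k - 2) => relVec m u (n + 3)) := by
      rcases (by omega : n = 1 ∨ n = 2 ∨ 3 ≤ n) with rfl | rfl | h
      · rw [relVec_one (by omega)]; exact zero_mem _
      · rw [relVec_two hu]; exact zero_mem _
      · exact Submodule.subset_span ⟨⟨n - 3, by omega⟩, by simp [Nat.sub_add_cancel h]⟩
    refine Submodule.span_le.mpr ?_
    rintro v ⟨⟨i, j⟩, hp, rfl⟩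
    obtain ⟨hi, hj, hle, hc⟩ := (mem_equalitySet_aperyPoint_iff (by omega) (by omega) hkm i j).mp
      hp
    have : hypVec m i j = relVec m u i.val + relVec m u j.val - relVec m u (i.val + j.val) := by
      rw [relVec_add hc]
      simp [hypVec, stdVec]
    rw [SetLike.mem_coe, this]
    exact sub_mem (add_mem (hmem _ hi (by omega)) (hmem _ hj (by omega)))
      (hmem _ (by omega) hle)
  · refine Submodule.span_le.mpr ?_
    rintro _ ⟨n, rfl⟩
    exact relVec_mem_relSpan hu huk hkm (by omega) (by omega)

theorem linearIndependent_relVec (hkm : k < m) :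
    LinearIndependent ℚ fun n : Fin (k - 2) => relVec m u (n + 3) := by
  rw [Fintype.linearIndependent_iff]
  intro g hg b
  have := congrFun hg ((b + 3 : ℕ) : ZMod m)
  simp only [Finset.sum_apply, Pi.smul_apply, relVec_apply hkm] at this
  simpa using this

theorem kunzD_aperyPoint (hu : 2 ≤ u) (huk : u + 2 ≤ k) (hkm : k < m) :
    kunzD m (aperyPoint m u k) = m + 1 - k := by
  have : Module.finrank ℚ (relSpan m u k) = k - 2 := by
    rw [relSpan_eq_span_range hu huk hkm, finrank_span_eq_card (linearIndependent_relVec hkm),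
      Fintype.card_fin]
  rw [kunzD, ← relSpan, this]
  omega

end dimension

/-- For `m ≥ 7`, `2 ≤ e ≤ m - 3`, and `2 ≤ d ≤ e` there is an Apéry face of `C_m` with
`e(F) = e` and `d(F) = d`. -/
theorem exists_apery_face_with_embdim_and_dim (m : ℕ) (hm : 7 ≤ m) [NeZero m]
    (e d : ℕ) (he1 : 2 ≤ e) (he2 : e ≤ m - 3) (hd1 : 2 ≤ d) (hd2 : d ≤ e) :
    ∃ x y : ZMod m → ℝ, x ∈ KunzCone m ∧ (∀ i : ZMod m, i ≠ 0 → 0 < x i) ∧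
      IsAperyPoint m y ∧ EqualitySet m y = EqualitySet m x ∧
      kunzE m x = e ∧ kunzD m x = d := by
  have hu : 2 ≤ e - d + 2 := by omega
  have huk : e - d + 2 + 2 ≤ m + 1 - d := by omega
  have hkm : m + 1 - d < m := by omega
  refine ⟨aperyPoint m (e - d + 2) (m + 1 - d), aperyPoint m (e - d + 2) (m + 1 - d),
    aperyPoint_mem_kunzCone (by omega) (by omega), fun _ => aperyPoint_pos,
    isAperyPoint_aperyPoint (by omega) (by omega), rfl, ?_, ?_⟩
  · rw [kunzE_aperyPoint (by omega) (by omega) hkm]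
    omega
  · rw [kunzD_aperyPoint hu huk hkm]
    omega
end
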